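/- arXiv:1703.00176 — 4 statements merged into one kernel-verified Lean document; each statement's English description precedes it below -/
import Mathlib

section
/- Let E ⊆ [0,∞) be a nonempty, bounded, Lebesgue-measurable set and t > 0. Then the relative t-neighborhood satisfies m(E^t) ≥ m(E) + t + min(t, inf E). -/
open MeasureTheory Set Filter

/-- The relative `r`-neighborhood of a set `E ⊆ [0,∞)` inside the half-line:
`E^r = {x ∈ [0,∞) : dist(x,E) < r}`. -/
def relNbhd (E : Set ℝ) (r : ℝ) : Set ℝ := {x : ℝ | 0 ≤ x ∧ ∃ e ∈ E, |x - e| < r}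

/-- for a nonempty bounded measurable `E ⊆ [0,∞)` and `t > 0`,
`m(E^t) ≥ m(E) + t + min(t, inf E)`. -/
theorem stmt_3 (E : Set ℝ) (hne : E.Nonempty) (hbdd : Bornology.IsBounded E)
    (hmeas : MeasurableSet E) (hsub : E ⊆ Set.Ici 0) (t : ℝ) (ht : 0 < t) :
    volume E + ENNReal.ofReal (t + min t (sInf E)) ≤ volume (relNbhd E t) := by
  have hbelow : BddBelow E := hbdd.bddBelow
  have habove : BddAbove E := hbdd.bddAbove
  have ha : ∀ x ∈ E, sInf E ≤ x := fun x hx => csInf_le hbelow hx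
  have hb : ∀ x ∈ E, x ≤ sSup E := fun x hx => le_csSup habove hx
  have ha0 : 0 ≤ sInf E := le_csInf hne hsub
  have hab : sInf E ≤ sSup E := csInf_le_csSup hne hbelow habove
  have hmin : 0 ≤ min t (sInf E) := le_min ht.le ha0
  have hR : Disjoint E (Ioo (sSup E) (sSup E + t)) :=
    Set.disjoint_left.2 fun x hx hx' => (hb x hx).not_gt hx'.1
  have hL : Disjoint (E ∪ Ioo (sSup E) (sSup E + t))
      (Ioo (sInf E - min t (sInf E)) (sInf E)) := by
    refine Set.disjoint_left.2 ?_
    rintro x (hx | hx) hx'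
    · exact (ha x hx).not_gt hx'.2
    · linarith [hx.1, hx'.2]
  calc volume E + ENNReal.ofReal (t + min t (sInf E))
      = volume (E ∪ Ioo (sSup E) (sSup E + t) ∪
          Ioo (sInf E - min t (sInf E)) (sInf E)) := by
        rw [measure_union hL measurableSet_Ioo, measure_union hR measurableSet_Ioo,
          Real.volume_Ioo, Real.volume_Ioo, add_sub_cancel_left, sub_sub_cancel,
          ENNReal.ofReal_add ht.le hmin, add_assoc]
    _ ≤ volume (relNbhd E t) := by
        refine measure_mono ?_
        rintro x ((hx | ⟨hx₁, hx₂⟩) | ⟨hx₁, hx₂⟩)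
        · exact ⟨hsub hx, x, hx, by simpa using ht⟩
        · obtain ⟨e, he, hxe⟩ := exists_lt_of_lt_csSup hne (show x - t < sSup E by linarith)
          have := hb e he
          exact ⟨by linarith, e, he, abs_lt.2 ⟨by linarith, by linarith⟩⟩
        · have h₁ := min_le_left t (sInf E)
          have h₂ := min_le_right t (sInf E)
          obtain ⟨e, he, hxe⟩ := exists_lt_of_csInf_lt hne (show sInf E < x + t by linarith)
          have := ha e he
          exact ⟨by linarith, e, he, abs_lt.2 ⟨by linarith, by linarith⟩⟩
end

section
/- Let x₀ ∈ [0,∞). Let (E_n) be a sequence of elementary sets and, for each t > 0, let E(t) ⊆ {x₀}^t be a Lebesgue-measurable set such that for every t > 0 and every L > 0, m((E_n^t Δ E(t)) ∩ (0,L)) → 0 as n → ∞. Assume there exists t₀ > 0 with m(E(t₀)) > 0. Then for every t > 0 one has m(E(t) Δ {x₀}^t) = 0; equivalently, m(E(t)) ≥ min(2t, x₀ + t) = m({x₀}^t) for all t > 0. -/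
open MeasureTheory Set Filter

/-- An elementary subset of the half-line: a finite union of open intervals
`(a₁,b₁) ∪ … ∪ (aₙ,bₙ)` with `0 ≤ a₁ < b₁ < a₂ < b₂ < … < aₙ < bₙ ≤ ∞`
(the right endpoints are allowed to be `+∞`). -/
def IsElementary (E : Set ℝ) : Prop :=
  ∃ (n : ℕ) (a : Fin n → ℝ) (b : Fin n → EReal),
    (∀ j, 0 ≤ a j) ∧ (∀ j, (a j : EReal) < b j) ∧
    (∀ j k : Fin n, j < k → b j < (a k : EReal)) ∧
    E = ⋃ j, {x : ℝ | a j < x ∧ (x : EReal) < b j}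

theorem IsElementary.nonneg {E : Set ℝ} (hE : IsElementary E) {x : ℝ} (hx : x ∈ E) : 0 ≤ x := by
  obtain ⟨n, a, b, ha, -, -, rfl⟩ := hE
  obtain ⟨j, hj, -⟩ := mem_iUnion.1 hx
  exact (ha j).trans hj.le

/-- If the `δ`-neighborhood of `E` is close in measure to a subset of `{x₀}^δ`, then the points
of `E` in a bounded region are close to `x₀`. -/
theorem abs_sub_lt_of_volume_symmDiff_lt {x₀ δ M : ℝ} {E F : Set ℝ}
    (hE : ∀ x ∈ E, 0 ≤ x) (hF : F ⊆ relNbhd {x₀} δ)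
    (h : volume (symmDiff (relNbhd E δ) F ∩ Ioo 0 (M + δ)) < ENNReal.ofReal δ)
    {e : ℝ} (he : e ∈ E) (heM : e ≤ M) : |e - x₀| < 2 * δ := by
  by_contra! hfar
  have he0 := hE e he
  have hsub : Ioo e (e + δ) ⊆ symmDiff (relNbhd E δ) F ∩ Ioo 0 (M + δ) := by
    rintro x ⟨hx1, hx2⟩
    refine ⟨Or.inl ⟨⟨by linarith, e, he, abs_lt.2 ⟨by linarith, by linarith⟩⟩, fun hxF => ?_⟩,
      by linarith, by linarith⟩
    obtain ⟨-, y, rfl, hy⟩ := hF hxF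
    obtain ⟨h1, h2⟩ := abs_lt.1 hy
    rcases le_abs.1 hfar with h3 | h3 <;> linarith
  have := measure_mono (μ := volume) hsub
  rw [Real.volume_Ioo, add_sub_cancel_left] at this
  exact absurd h this.not_gt

/-- If the `t`-neighborhood of `E` is close in measure to a subset of `{x₀}^t`, then `E` has a
point in a bounded region. -/
theorem exists_mem_le_of_volume_symmDiff_lt {x₀ t : ℝ} {E F : Set ℝ}
    (hF : F ⊆ relNbhd {x₀} t)
    (h : volume (symmDiff (relNbhd E t) F ∩ Ioo 0 (x₀ + t)) < volume F) :
    ∃ e ∈ E, e ≤ x₀ + 2 * t := by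
  by_contra! hfar
  have hsub : F ⊆ insert 0 (symmDiff (relNbhd E t) F ∩ Ioo 0 (x₀ + t)) := by
    intro x hx
    obtain ⟨h0, y, rfl, hy⟩ := hF hx
    obtain ⟨h1, h2⟩ := abs_lt.1 hy
    rcases h0.eq_or_lt with h0 | h0
    · exact Or.inl h0.symm
    refine Or.inr ⟨Or.inr ⟨hx, ?_⟩, h0, by linarith⟩
    rintro ⟨-, e, he, hxe⟩
    have := hfar e he
    linarith [(abs_lt.1 hxe).1]
  have := measure_mono (μ := volume) hsub
  rw [measure_congr (insert_ae_eq_self _ _)] at this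
  exact absurd h this.not_gt

/-- if the `t`-neighborhoods of a sequence of elementary sets converge locally
in measure to measurable sets `F t ⊆ {x₀}^t` for every `t > 0`, and `F t₀` has positive
measure for some `t₀ > 0`, then `m(F t Δ {x₀}^t) = 0` for every `t > 0`. -/
theorem stmt_7 (x₀ : ℝ) (hx₀ : 0 ≤ x₀) (E : ℕ → Set ℝ) (hE : ∀ n, IsElementary (E n))
    (F : ℝ → Set ℝ) (hFmeas : ∀ t : ℝ, 0 < t → MeasurableSet (F t))
    (hFsub : ∀ t : ℝ, 0 < t → F t ⊆ relNbhd {x₀} t)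
    (hconv : ∀ t : ℝ, 0 < t → ∀ L : ℝ, 0 < L →
      Tendsto (fun n => volume (symmDiff (relNbhd (E n) t) (F t) ∩ Set.Ioo 0 L))
        atTop (nhds 0))
    (hpos : ∃ t₀ : ℝ, 0 < t₀ ∧ 0 < volume (F t₀)) :
    ∀ t : ℝ, 0 < t → volume (symmDiff (F t) (relNbhd {x₀} t)) = 0 := by
  obtain ⟨t₀, ht₀, hFt₀⟩ := hpos
  have hnear : ∀ ε : ℝ, 0 < ε → ∀ᶠ n in atTop, ∃ e ∈ E n, |e - x₀| < ε := by
    intro ε hε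
    filter_upwards [(hconv t₀ ht₀ (x₀ + t₀) (by linarith)).eventually_lt_const hFt₀,
      (hconv (ε / 2) (by linarith) (x₀ + 2 * t₀ + ε / 2) (by linarith)).eventually_lt_const
        (ENNReal.ofReal_pos.2 (half_pos hε))] with n h1 h2
    obtain ⟨e, he, hle⟩ := exists_mem_le_of_volume_symmDiff_lt (hFsub t₀ ht₀) h1
    have := abs_sub_lt_of_volume_symmDiff_lt (fun x hx => (hE n).nonneg hx)
      (hFsub _ (half_pos hε)) h2 he hle
    exact ⟨e, he, by linarith⟩
  intro t ht
  have hnull : ∀ ε : ℝ, 0 < ε → volume (relNbhd {x₀} (t - ε) \ F t) = 0 := by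
    intro ε hε
    refine le_antisymm (ge_of_tendsto (hconv t ht (x₀ + t) (by linarith)) ?_) zero_le
    filter_upwards [hnear ε hε] with n ⟨e, he, hex⟩
    refine (measure_mono ?_).trans (measure_congr (insert_ae_eq_self (0 : ℝ) _)).le
    rintro x ⟨⟨h0, y, rfl, hy⟩, hxF⟩
    rcases h0.eq_or_lt with h0' | h0'
    · exact Or.inl h0'.symm
    obtain ⟨h1, h2⟩ := abs_lt.1 hy
    obtain ⟨h3, h4⟩ := abs_lt.1 hex
    exact Or.inr ⟨Or.inl ⟨⟨h0, e, he, abs_lt.2 ⟨by linarith, by linarith⟩⟩, hxF⟩,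
      h0', by linarith⟩
  refine measure_mono_null ?_ (measure_iUnion_null fun k : ℕ =>
    hnull (1 / ((k : ℝ) + 1)) Nat.one_div_pos_of_nat)
  rintro x (⟨hx, hx'⟩ | ⟨⟨h0, y, rfl, hy⟩, hxF⟩)
  · exact absurd (hFsub t ht hx) hx'
  · obtain ⟨k, hk⟩ := exists_nat_one_div_lt (sub_pos.2 hy)
    exact mem_iUnion.2 ⟨k, ⟨h0, y, rfl, by linarith⟩, hxF⟩
end

section
/- Let (E_n) be a sequence of elementary sets and, for each t > 0, let E(t) ⊆ [0,∞) be a Lebesgue-measurable set such that for every t > 0 and every L > 0, m((E_n^t Δ E(t)) ∩ (0,L)) → 0 as n → ∞. Assume there exist t₀ > 0 and M > 0 with m(E(t₀) ∩ (0,M)) > 0. Then there exists x₀ ∈ [0,∞) such that for every t > 0, m({x₀}^t \ E(t)) = 0, i.e. every such limit trajectory essentially contains the trajectory of relative neighborhoods of some point of the half-line. -/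
open MeasureTheory Set Filter

theorem IsElementary.subset_Ici {E : Set ℝ} (hE : IsElementary E) : E ⊆ Set.Ici 0 := by
  obtain ⟨n, a, b, ha, -, -, rfl⟩ := hE
  intro x hx
  obtain ⟨j, hj, -⟩ := Set.mem_iUnion.1 hx
  exact (ha j).trans hj.le

/-- If the neighborhoods of sets `E n` converge in measure to a set charging `(0, M)`, then
eventually the sets `E n` meet `(-∞, M + t]`. -/
theorem eventually_exists_mem_le {E : ℕ → Set ℝ} {G : Set ℝ} {t M : ℝ}
    (hconv : Tendsto (fun n => volume (symmDiff (relNbhd (E n) t) G ∩ Set.Ioo 0 M))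
      atTop (nhds 0))
    (hpos : 0 < volume (G ∩ Set.Ioo 0 M)) :
    ∀ᶠ n in atTop, ∃ e ∈ E n, e ≤ M + t := by
  filter_upwards [hconv.eventually_lt_const hpos] with n hn
  by_contra! h
  refine hn.not_ge (measure_mono ?_)
  rintro x ⟨hxG, hx⟩
  refine ⟨Or.inr ⟨hxG, ?_⟩, hx⟩
  rintro ⟨-, e, he, hxe⟩
  have := h e he
  have := hx.2
  rw [abs_lt] at hxe
  linarith

/-- If points `e k ∈ E k` converge to `x` and the `t`-neighborhoods of the `E k` converge locally
in measure to `G`, then smaller neighborhoods of `x` are essentially contained in `G`. -/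
theorem volume_relNbhd_singleton_inter_diff_eq_zero {E : ℕ → Set ℝ} {G : Set ℝ} {e : ℕ → ℝ}
    {x s t L : ℝ} (he : ∀ k, e k ∈ E k) (hx : Tendsto e atTop (nhds x)) (hst : s < t)
    (hconv : Tendsto (fun n => volume (symmDiff (relNbhd (E n) t) G ∩ Set.Ioo 0 L))
      atTop (nhds 0)) :
    volume ((relNbhd {x} s ∩ Set.Ioo 0 L) \ G) = 0 := by
  refine le_antisymm (ge_of_tendsto hconv ?_) zero_le
  filter_upwards [Metric.tendsto_nhds.1 hx (t - s) (sub_pos.2 hst)] with k hk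
  refine measure_mono ?_
  rintro y ⟨⟨⟨hy0, z, rfl, hyz⟩, hyL⟩, hyG⟩
  refine ⟨Or.inl ⟨⟨hy0, e k, he k, ?_⟩, hyG⟩, hyL⟩
  rw [Real.dist_eq, abs_sub_comm] at hk
  linarith [abs_sub_le y z (e k)]

/-- if the `t`-neighborhoods of a sequence of elementary sets converge locally
in measure to measurable sets `F t ⊆ [0,∞)`, and `F t₀ ∩ (0,M)` has positive measure for
some `t₀ > 0`, `M > 0`, then there is a point `x₀ ∈ [0,∞)` such that, for every `t > 0`,
`{x₀}^t` is essentially contained in `F t`: `m({x₀}^t \ F t) = 0`. -/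
theorem stmt_8 (E : ℕ → Set ℝ) (hE : ∀ n, IsElementary (E n))
    (F : ℝ → Set ℝ) (hFmeas : ∀ t : ℝ, 0 < t → MeasurableSet (F t))
    (hFsub : ∀ t : ℝ, 0 < t → F t ⊆ Set.Ici 0)
    (hconv : ∀ t : ℝ, 0 < t → ∀ L : ℝ, 0 < L →
      Tendsto (fun n => volume (symmDiff (relNbhd (E n) t) (F t) ∩ Set.Ioo 0 L))
        atTop (nhds 0))
    (hpos : ∃ t₀ M : ℝ, 0 < t₀ ∧ 0 < M ∧ 0 < volume (F t₀ ∩ Set.Ioo 0 M)) :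
    ∃ x₀ : ℝ, 0 ≤ x₀ ∧ ∀ t : ℝ, 0 < t → volume (relNbhd {x₀} t \ F t) = 0 := by
  obtain ⟨t₀, M, ht₀, hM, hpos⟩ := hpos
  obtain ⟨N, hN⟩ := eventually_atTop.1 (eventually_exists_mem_le (hconv t₀ ht₀ M hM) hpos)
  choose e heE heM using fun k => hN (N + k) (Nat.le_add_right N k)
  obtain ⟨x₀, hx₀, φ, hφ, hlim⟩ := (isCompact_Icc (a := (0 : ℝ)) (b := M + t₀)).tendsto_subseq
    fun k => ⟨(hE (N + k)).subset_Ici (heE k), heM k⟩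
  have hN_lim : Tendsto (fun k => N + φ k) atTop atTop :=
    tendsto_atTop_mono (fun k => Nat.le_add_left _ _) hφ.tendsto_atTop
  refine ⟨x₀, hx₀.1, fun t ht => ?_⟩
  have hnull (k : ℕ) :
      volume ((relNbhd {x₀} (t - 1 / (k + 1)) ∩ Set.Ioo 0 (x₀ + t)) \ F t) = 0 :=
    volume_relNbhd_singleton_inter_diff_eq_zero (E := fun k => E (N + φ k))
      (fun k => heE (φ k)) hlim (sub_lt_self t Nat.one_div_pos_of_nat)
      ((hconv t ht _ (add_pos_of_nonneg_of_pos hx₀.1 ht)).comp hN_lim)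
  refine measure_mono_null ?_ (measure_union_null (Real.volume_singleton (a := 0))
    (measure_iUnion_null hnull))
  rintro y ⟨⟨hy0, z, rfl, hyz⟩, hyF⟩
  rcases hy0.eq_or_lt with rfl | hy0'
  · exact Or.inl rfl
  · obtain ⟨k, hk⟩ := exists_nat_one_div_lt (sub_pos.2 hyz)
    refine Or.inr (Set.mem_iUnion.2 ⟨k, ⟨⟨hy0, z, rfl, by linarith⟩, hy0', ?_⟩, hyF⟩)
    linarith [le_abs_self (y - z)]
end

section
/- Let T > 0, let w be a continuous complex-valued function on the square [0,T] × [0,T], and let y be a continuous complex-valued function on [0,T]. Then there exists a unique continuous function f on [0,T] satisfying the Volterra integral equation of the second kind f(T−x) + ∫_x^T w(x,s)·f(T−s) ds = y(x) for all x ∈ [0,T]. -/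
open MeasureTheory Set Filter intervalIntegral

/-- A Volterra equation whose kernel has total mass at most `1 / 2` on every `[x, T]` has exactly
one continuous solution. -/
theorem existsUnique_volterra_of_integral_norm_le {T : ℝ} (hT : 0 ≤ T) {K : ℝ × ℝ → ℂ}
    (hK : Continuous K) {y : ℝ → ℂ} (hy : Continuous y)
    (hle : ∀ x ∈ Icc 0 T, ∫ s in x..T, ‖K (x, s)‖ ≤ 1 / 2) :
    ∃! u : C(Icc 0 T, ℂ), ∀ x : Icc 0 T,
      u x + ∫ s in (x : ℝ)..T, K (x, s) * u (projIcc 0 T hT s) = y x := by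
  have hcont (u : C(Icc 0 T, ℂ)) : Continuous fun x : ℝ ↦
      ∫ s in x..T, K (x, s) * u (projIcc 0 T hT s) := by
    have h : Continuous fun x : ℝ ↦ ∫ s in T..x, K (x, s) * u (projIcc 0 T hT s) :=
      continuous_parametric_intervalIntegral_of_continuous
        (f := fun x s ↦ K (x, s) * u (projIcc 0 T hT s))
        (by
          have := continuous_projIcc (h := hT)
          simp only [Function.uncurry_def]
          fun_prop) continuous_id
    exact h.neg.congr fun x ↦ (integral_symm _ _).symm
  let A : C(Icc 0 T, ℂ) → C(Icc 0 T, ℂ) := fun u ↦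
    ⟨fun x ↦ y x - ∫ s in (x : ℝ)..T, K (x, s) * u (projIcc 0 T hT s),
      (hy.sub (hcont u)).comp continuous_subtype_val⟩
  have hA : ContractingWith (1 / 2) A := by
    refine ⟨by norm_num, LipschitzWith.of_dist_le_mul fun u v ↦ ?_⟩
    refine (ContinuousMap.dist_le (by positivity)).2 fun x ↦ ?_
    have hint (u : C(Icc 0 T, ℂ)) : IntervalIntegrable
        (fun s ↦ K (x, s) * u (projIcc 0 T hT s)) volume x T := by
      have := continuous_projIcc (h := hT)
      exact Continuous.intervalIntegrable (by fun_prop) _ _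
    have hKint : Continuous fun s ↦ ‖K (x, s)‖ * dist u v := by fun_prop
    calc dist (A u x) (A v x)
        = ‖∫ s in (x : ℝ)..T, (K (x, s) * u (projIcc 0 T hT s)
            - K (x, s) * v (projIcc 0 T hT s))‖ := by
          rw [integral_sub (hint u) (hint v), dist_comm, dist_eq_norm]
          simp [A]
      _ ≤ ∫ s in (x : ℝ)..T, ‖K (x, s)‖ * dist u v := by
          refine norm_integral_le_of_norm_le x.2.2 (.of_forall fun s _ ↦ ?_)
            (hKint.intervalIntegrable _ _)
          rw [← mul_sub, norm_mul, ← dist_eq_norm]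
          gcongr
          exact ContinuousMap.dist_apply_le_dist _
      _ = (∫ s in (x : ℝ)..T, ‖K (x, s)‖) * dist u v := integral_mul_const _ _
      _ ≤ 1 / 2 * dist u v := by
          gcongr
          exact hle x x.2
      _ = _ := by simp
  have hfix (u : C(Icc 0 T, ℂ)) : (∀ x : Icc 0 T,
      u x + ∫ s in (x : ℝ)..T, K (x, s) * u (projIcc 0 T hT s) = y x) ↔
      Function.IsFixedPt A u := by
    rw [Function.IsFixedPt, ContinuousMap.ext_iff]
    refine forall_congr' fun x ↦ ?_
    rw [← eq_sub_iff_add_eq, eq_comm]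
    rfl
  exact ⟨hA.fixedPoint A, (hfix _).2 hA.fixedPoint_isFixedPt,
    fun u hu ↦ hA.fixedPoint_unique ((hfix u).1 hu)⟩

/-- The Volterra equation of the second kind with continuous kernel has exactly one continuous
solution. -/
theorem existsUnique_volterra {T : ℝ} (hT : 0 ≤ T) {K : ℝ × ℝ → ℂ}
    (hK : Continuous K) {y : ℝ → ℂ} (hy : Continuous y) :
    ∃! u : C(Icc 0 T, ℂ), ∀ x : Icc 0 T,
      u x + ∫ s in (x : ℝ)..T, K (x, s) * u (projIcc 0 T hT s) = y x := by
  obtain ⟨M, hM⟩ := (isCompact_Icc.prod isCompact_Icc :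
    IsCompact (Icc 0 T ×ˢ Icc 0 T)).exists_bound_of_continuousOn hK.continuousOn
  have hM0 : 0 ≤ M := (norm_nonneg _).trans (hM (0, 0) (by simp [hT]))
  set l : ℝ := 2 * M + 1 with hl
  have hl0 : 0 < l := by positivity
  let e : ℝ → ℂ := fun x ↦ (Real.exp (l * x) : ℂ)
  have he : Continuous e := by fun_prop
  have he0 (x : ℝ) : e x ≠ 0 := by simp [e]
  have hnorm (x : ℝ) : ‖e x‖ = Real.exp (l * x) := by
    simp only [e, Complex.norm_real, Real.norm_eq_abs, Real.abs_exp]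
  have hK' : Continuous fun p : ℝ × ℝ ↦ e p.1 * K p * (e p.2)⁻¹ := by
    have : Continuous fun p : ℝ × ℝ ↦ (e p.2)⁻¹ :=
      (he.comp continuous_snd).inv₀ fun p ↦ he0 _
    fun_prop
  have hle : ∀ x ∈ Icc 0 T, ∫ s in x..T, ‖e x * K (x, s) * (e s)⁻¹‖ ≤ 1 / 2 := by
    intro x hx
    have hcont : Continuous fun s ↦ M * Real.exp (l * (x - s)) := by fun_prop
    calc ∫ s in x..T, ‖e x * K (x, s) * (e s)⁻¹‖
        ≤ ∫ s in x..T, M * Real.exp (l * (x - s)) := by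
          refine integral_mono_on hx.2
            ((hK'.comp (Continuous.prodMk_right x)).norm.intervalIntegrable _ _)
            (hcont.intervalIntegrable _ _) fun s hs ↦ ?_
          rw [norm_mul, norm_mul, norm_inv, hnorm, hnorm, mul_sub, Real.exp_sub, div_eq_mul_inv,
            mul_comm (Real.exp (l * x)), mul_assoc]
          gcongr
          exact hM (x, s) ⟨hx, hx.1.trans hs.1, hs.2⟩
      _ = -(M / l) * Real.exp (l * (x - T)) - -(M / l) * Real.exp (l * (x - x)) := by
          refine integral_eq_sub_of_hasDerivAt
            (f := fun s ↦ -(M / l) * Real.exp (l * (x - s))) (fun s _ ↦ ?_)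
            (hcont.intervalIntegrable _ _)
          refine ((((hasDerivAt_id' s).const_sub x).const_mul l).exp.const_mul
            (-(M / l))).congr_deriv ?_
          field_simp
      _ ≤ M / l := by
          have : 0 ≤ M / l * Real.exp (l * (x - T)) := by positivity
          simp only [sub_self, mul_zero, Real.exp_zero]
          linarith
      _ ≤ 1 / 2 := by
          rw [div_le_div_iff₀ hl0 two_pos]
          linarith
  have key (u v : C(Icc 0 T, ℂ)) (huv : ∀ x : Icc 0 T, v x = e x * u x) :
      (∀ x : Icc 0 T, u x + ∫ s in (x : ℝ)..T, K (x, s) * u (projIcc 0 T hT s) = y x) ↔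
      ∀ x : Icc 0 T, v x + ∫ s in (x : ℝ)..T, e x * K (x, s) * (e s)⁻¹ *
        v (projIcc 0 T hT s) = e x * y x := by
    refine forall_congr' fun x ↦ ?_
    have : ∫ s in (x : ℝ)..T, e x * K (x, s) * (e s)⁻¹ * v (projIcc 0 T hT s) =
        e x * ∫ s in (x : ℝ)..T, K (x, s) * u (projIcc 0 T hT s) := by
      rw [← intervalIntegral.integral_const_mul]
      refine integral_congr fun s hs ↦ ?_
      rw [uIcc_of_le x.2.2] at hs
      have hs' : s ∈ Icc 0 T := ⟨x.2.1.trans hs.1, hs.2⟩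
      simp only [huv, projIcc_of_mem hT hs']
      have := he0 s
      field_simp
    rw [this, huv, ← mul_add, mul_right_inj' (he0 x)]
  obtain ⟨v, hv, hv_unique⟩ := existsUnique_volterra_of_integral_norm_le hT hK' (he.mul hy) hle
  refine ⟨⟨fun x ↦ (e x)⁻¹ * v x, ?_⟩, ?_, fun u hu ↦ ?_⟩
  · exact ((he.comp continuous_subtype_val).inv₀ fun x ↦ he0 _).mul v.continuous
  · refine (key _ v fun x ↦ ?_).2 hv
    simp [mul_inv_cancel_left₀ (he0 x)]
  · have := hv_unique ⟨fun x ↦ e x * u x, by fun_prop⟩ ((key u _ fun x ↦ rfl).1 hu)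
    ext x
    simp [← this, inv_mul_cancel_left₀ (he0 x)]

/-- existence and uniqueness of the continuous solution of the Volterra
integral equation of the second kind `f(T−x) + ∫ₓᵀ w(x,s) f(T−s) ds = y(x)`, `x ∈ [0,T]`. -/
theorem stmt_13 (T : ℝ) (hT : 0 < T)
    (w : ℝ × ℝ → ℂ) (hw : ContinuousOn w (Set.Icc 0 T ×ˢ Set.Icc 0 T))
    (y : ℝ → ℂ) (hy : ContinuousOn y (Set.Icc 0 T)) :
    (∃ f : ℝ → ℂ, ContinuousOn f (Set.Icc 0 T) ∧
        ∀ x ∈ Set.Icc 0 T, f (T - x) + ∫ s in x..T, w (x, s) * f (T - s) = y x)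
    ∧ ∀ f g : ℝ → ℂ, ContinuousOn f (Set.Icc 0 T) → ContinuousOn g (Set.Icc 0 T) →
        (∀ x ∈ Set.Icc 0 T, f (T - x) + ∫ s in x..T, w (x, s) * f (T - s) = y x) →
        (∀ x ∈ Set.Icc 0 T, g (T - x) + ∫ s in x..T, w (x, s) * g (T - s) = y x) →
        Set.EqOn f g (Set.Icc 0 T) := by
  let p : ℝ → Icc (0 : ℝ) T := projIcc 0 T hT.le
  have hp : Continuous p := continuous_projIcc
  have hp_mem {x : ℝ} (hx : x ∈ Icc 0 T) : (p x : ℝ) = x :=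
    congrArg Subtype.val (projIcc_of_mem hT.le hx)
  have hsub {x : ℝ} (hx : x ∈ Icc 0 T) : T - x ∈ Icc 0 T :=
    ⟨sub_nonneg.2 hx.2, sub_le_self _ hx.1⟩
  have hK : Continuous fun q : ℝ × ℝ ↦ w (p q.1, p q.2) :=
    hw.comp_continuous (by fun_prop) fun q ↦ ⟨(p q.1).2, (p q.2).2⟩
  have hY : Continuous fun x : ℝ ↦ y (p x) :=
    hy.comp_continuous (by fun_prop) fun x ↦ (p x).2
  have key (f : ℝ → ℂ) (u : C(Icc 0 T, ℂ)) (hfu : ∀ x : Icc 0 T, u x = f (T - x)) :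
      (∀ x ∈ Icc 0 T, f (T - x) + ∫ s in x..T, w (x, s) * f (T - s) = y x) ↔
      ∀ x : Icc 0 T, u x + ∫ s in (x : ℝ)..T, w (p x, p s) * u (p s) = y (p x) := by
    rw [Subtype.forall]
    refine forall₂_congr fun x hx ↦ ?_
    have : ∫ s in x..T, w (p x, p s) * u (p s) = ∫ s in x..T, w (x, s) * f (T - s) := by
      refine integral_congr fun s hs ↦ ?_
      rw [uIcc_of_le hx.2] at hs
      simp only [hfu, hp_mem hx, hp_mem ⟨hx.1.trans hs.1, hs.2⟩]
    rw [this, hfu, hp_mem hx]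
  obtain ⟨u, hu, hu_unique⟩ := existsUnique_volterra hT.le hK hY
  have huniq (f : ℝ → ℂ) (hf : ContinuousOn f (Icc 0 T))
      (hfe : ∀ x ∈ Icc 0 T, f (T - x) + ∫ s in x..T, w (x, s) * f (T - s) = y x)
      {x : ℝ} (hx : x ∈ Icc 0 T) : f x = u (p (T - x)) := by
    have := hu_unique ⟨fun x ↦ f (T - x), hf.comp_continuous (by fun_prop) fun x ↦ hsub x.2⟩
      ((key f _ fun x ↦ rfl).1 hfe)
    simp [← this, hp_mem (hsub hx)]
  refine ⟨⟨fun x ↦ u (p (T - x)), by fun_prop, (key (fun x ↦ u (p (T - x))) u fun x ↦ ?_).2 hu⟩,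
    fun f g hf hg hfe hge x hx ↦ ?_⟩
  · simp [p]
  · rw [huniq f hf hfe hx, huniq g hg hge hx]
end
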